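/- Let G be a finite nilpotent group each of whose Sylow subgroups is cyclic, isomorphic to the quaternion group Q₈, or isomorphic to ℤ_p × ℤ_p for some prime p. Then for all subgroups H, K of G with H ⊆ K, φ(H) divides φ(K). -/

import Mathlib

/-- For a finite group `G`, `phi G` is the number of elements of `G` whose order
equals the exponent of `G`. -/
noncomputable def phi (G : Type*) [Group G] : ℕ :=
  Nat.card {a : G // orderOf a = Monoid.exponent G}

theorem phi_congr {A B : Type*} [Group A] [Group B] (e : A ≃* B) : phi A = phi B :=
  Nat.card_congr (e.toEquiv.subtypeEquiv fun a => by
    have h : orderOf (e a) = orderOf a := e.orderOf_eq a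
    simp [h, Monoid.exponent_eq_of_mulEquiv e])

theorem phi_of_subsingleton (A : Type*) [Group A] [Subsingleton A] : phi A = 1 := by
  have h (a : A) : orderOf a = Monoid.exponent A := by
    rw [Subsingleton.elim a 1, orderOf_one, Monoid.exp_eq_one_of_subsingleton]
  rw [phi, Nat.card_congr (Equiv.subtypeUnivEquiv h)]
  exact Nat.card_unique

theorem phi_of_isCyclic (A : Type*) [Group A] [Finite A] [IsCyclic A] :
    phi A = (Nat.card A).totient := by
  classical
  have := Fintype.ofFinite A
  rw [phi, IsCyclic.exponent_eq_card, Nat.card_eq_fintype_card, Fintype.card_subtype,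
    Nat.card_eq_fintype_card]
  exact IsCyclic.card_orderOf_eq_totient dvd_rfl

/-- In a finite product of groups of pairwise coprime orders, an element has order equal to the
exponent if and only if each of its components does. -/
theorem orderOf_pi_eq_exponent_iff {ι : Type*} [Fintype ι] {M : ι → Type*} [∀ i, Group (M i)]
    [∀ i, Finite (M i)]
    (h : Pairwise fun i j => (Nat.card (M i)).Coprime (Nat.card (M j))) (x : ∀ i, M i) :
    orderOf x = Monoid.exponent (∀ i, M i) ↔ ∀ i, orderOf (x i) = Monoid.exponent (M i) := by
  classical
  rw [Monoid.exponent_pi, Pi.orderOf]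
  refine ⟨fun hx i => Nat.dvd_antisymm (Monoid.order_dvd_exponent _) ?_, fun hx => by simp [hx]⟩
  have hdvd : Monoid.exponent (M i) ∣
      orderOf (x i) * ∏ j ∈ Finset.univ.erase i, Nat.card (M j) := by
    refine (Finset.dvd_lcm (f := fun i => Monoid.exponent (M i)) (Finset.mem_univ i)).trans
      (hx ▸ Finset.lcm_dvd fun j _ => ?_)
    by_cases hij : j = i
    · subst hij
      exact dvd_mul_right _ _
    · exact ((orderOf_dvd_natCard (x j)).trans (Finset.dvd_prod_of_mem
        (fun j => Nat.card (M j)) (Finset.mem_erase.2 ⟨hij, Finset.mem_univ j⟩))).mul_left _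
  refine Nat.Coprime.dvd_of_dvd_mul_right ?_ hdvd
  exact Nat.Coprime.prod_right fun j hj =>
    (h (Finset.ne_of_mem_erase hj).symm).coprime_dvd_left Group.exponent_dvd_nat_card

theorem phi_pi {ι : Type*} [Fintype ι] (M : ι → Type*) [∀ i, Group (M i)] [∀ i, Finite (M i)]
    (h : Pairwise fun i j => (Nat.card (M i)).Coprime (Nat.card (M j))) :
    phi (∀ i, M i) = ∏ i, phi (M i) := by
  rw [phi, Nat.card_congr ((Equiv.subtypeEquivRight (orderOf_pi_eq_exponent_iff h)).trans
    (Equiv.subtypePiEquivPi (p := fun i (a : M i) => orderOf a = Monoid.exponent (M i)))),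
    Nat.card_pi]
  rfl

theorem phi_eq_prod_sylow (A : Type*) [Group A] [Finite A] [Group.IsNilpotent A] :
    phi A = ∏ p ∈ (Nat.card A).primeFactors, phi (default : Sylow p A) := by
  have hn : ∀ {p : ℕ} [Fact p.Prime] (P : Sylow p A), P.Normal := fun P => inferInstance
  have e (p : (Nat.card A).primeFactors) :
      (∀ P : Sylow p A, P) ≃* (default : Sylow p A) := by
    have : Fact (p : ℕ).Prime := ⟨Nat.prime_of_mem_primeFactors p.2⟩
    have u : Unique (Sylow p A) := Sylow.unique_of_normal default (hn _)
    rw [Subsingleton.elim (default : Sylow p A) u.default]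
    exact MulEquiv.piUnique _
  rw [← phi_congr (Sylow.directProductOfNormal hn), phi_congr (MulEquiv.piCongrRight e),
    phi_pi]
  · exact Finset.prod_coe_sort _ fun p => phi (default : Sylow p A)
  intro p q hpq
  have hp : Fact (p : ℕ).Prime := ⟨Nat.prime_of_mem_primeFactors p.2⟩
  have hq : Fact (q : ℕ).Prime := ⟨Nat.prime_of_mem_primeFactors q.2⟩
  exact IsPGroup.coprime_card_of_ne (p : ℕ) q (fun h => hpq (Subtype.ext h)) _ _
    (default : Sylow p A).isPGroup' (default : Sylow q A).isPGroup'

theorem phi_add_one_of_pow_prime_eq_one {A : Type*} [Group A] [Finite A] [Nontrivial A] {p : ℕ}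
    (hp : p.Prime) (h : ∀ x : A, x ^ p = 1) : phi A + 1 = Nat.card A := by
  have hexp : Monoid.exponent A = p :=
    ((Nat.dvd_prime hp).1 (Monoid.exponent_dvd_of_forall_pow_eq_one h)).resolve_left
      fun h1 => not_subsingleton A (Monoid.exp_eq_one_iff.1 h1)
  have hiff (a : A) : orderOf a = p ↔ a ∈ ({1}ᶜ : Set A) := by
    have : Fact p.Prime := ⟨hp⟩
    refine ⟨fun ha h1 => hp.one_lt.ne ?_, fun ha => orderOf_eq_prime (h a) ha⟩
    rw [← ha, Set.mem_singleton_iff.1 h1, orderOf_one]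
  rw [phi, hexp, Nat.card_congr (Equiv.subtypeEquivRight hiff),
    ← Set.ncard_add_ncard_compl ({1} : Set A), Set.ncard_singleton, add_comm]
  rfl

theorem phi_dvd_of_pow_prime_eq_one {G : Type*} [Group G] [Finite G] {A B : Subgroup G}
    (hAB : A ≤ B) {p : ℕ} (hp : p.Prime) (hB : ∀ x ∈ B, x ^ p = 1)
    (hcard : Nat.card B ∣ p ^ 2) : phi A ∣ phi B := by
  rcases subsingleton_or_nontrivial A with hA | hA
  · simp [phi_of_subsingleton]
  have hB' : Nontrivial B := (Subgroup.inclusion_injective hAB).nontrivial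
  have h1 := phi_add_one_of_pow_prime_eq_one hp fun x : A => Subtype.ext (hB x (hAB x.2))
  have h2 := phi_add_one_of_pow_prime_eq_one hp fun x : B => Subtype.ext (hB x x.2)
  have hdvd := Subgroup.card_dvd_of_le hAB
  have hA1 := Finite.one_lt_card (α := A)
  have hB1 := Finite.one_lt_card (α := B)
  have key (n : ℕ) (hn : n ∣ p ^ 2) (h : 1 < n) : n = p ∨ n = p ^ 2 := by
    obtain ⟨k, hk, rfl⟩ := (Nat.dvd_prime_pow hp).1 hn
    interval_cases k <;> simp_all
  rcases key _ hcard hB1 with h | h <;> rcases key _ (hdvd.trans hcard) hA1 with h' | h'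
  · exact (show phi A = phi B by omega) ▸ dvd_rfl
  · rw [h, h'] at hdvd
    have := Nat.le_of_dvd hp.pos hdvd
    nlinarith [hp.one_lt]
  · refine ⟨p + 1, ?_⟩
    rw [h'] at h1
    rw [h, ← h1] at h2
    rw [← h1]
    nlinarith
  · exact (show phi A = phi B by omega) ▸ dvd_rfl

theorem phi_of_pow_four_eq_one {A : Type*} [Group A] [Finite A] (h4 : ∀ x : A, x ^ 4 = 1)
    (hinv : ∀ x y : A, x ^ 2 = 1 → y ^ 2 = 1 → x ≠ 1 → y ≠ 1 → x = y) :
    (phi A = 1 ∧ Nat.card A ≤ 2) ∨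
      (4 ∣ Nat.card A ∧ phi A + 2 = Nat.card A) := by
  have hiff (a : A) : orderOf a = 4 ↔ a ^ 2 ≠ 1 := by
    refine ⟨fun ha h => ?_, fun ha => orderOf_eq_prime_pow (p := 2) (n := 1) ha (h4 a)⟩
    have := Nat.le_of_dvd two_pos (orderOf_dvd_of_pow_eq_one h)
    omega
  by_cases hg : ∃ g : A, g ^ 2 ≠ 1
  · obtain ⟨g, hg⟩ := hg
    have hexp : Monoid.exponent A = 4 :=
      Nat.dvd_antisymm (Monoid.exponent_dvd_of_forall_pow_eq_one h4)
        ((hiff g).2 hg ▸ Monoid.order_dvd_exponent g)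
    refine Or.inr ⟨(hiff g).2 hg ▸ orderOf_dvd_natCard g, ?_⟩
    have hg2 : (g ^ 2) ^ 2 = 1 := by rw [← pow_mul, h4]
    have hset (a : A) : orderOf a = 4 ↔ a ∈ ({1, g ^ 2}ᶜ : Set A) := by
      rw [hiff, Set.mem_compl_iff, not_iff_not]
      refine ⟨fun ha => ?_, ?_⟩
      · by_cases h1 : a = 1
        · exact Or.inl h1
        · exact Or.inr (hinv _ _ ha hg2 h1 hg)
      · rintro (rfl | rfl)
        · exact one_pow 2
        · exact hg2
    rw [phi, hexp, Nat.card_congr (Equiv.subtypeEquivRight hset),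
      ← Set.ncard_add_ncard_compl ({1, g ^ 2} : Set A), Set.ncard_pair hg.symm, add_comm]
    rfl
  · push Not at hg
    rcases subsingleton_or_nontrivial A with hA | hA
    · exact Or.inl ⟨phi_of_subsingleton A, by simp⟩
    obtain ⟨z, hz⟩ := exists_ne (1 : A)
    have hcard : Nat.card A = 2 := by
      rw [Nat.card_eq_two_iff]
      refine ⟨1, z, hz.symm, Set.eq_univ_of_forall fun a => ?_⟩
      by_cases h1 : a = 1
      · exact Or.inl h1
      · exact Or.inr (hinv _ _ (hg a) (hg z) h1 hz)
    have := phi_add_one_of_pow_prime_eq_one Nat.prime_two hg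
    omega

theorem phi_dvd_of_pow_four_eq_one {G : Type*} [Group G] [Finite G] {A B : Subgroup G}
    (hAB : A ≤ B) (h4 : ∀ x ∈ B, x ^ 4 = 1)
    (hinv : ∀ x ∈ B, ∀ y ∈ B, x ^ 2 = 1 → y ^ 2 = 1 → x ≠ 1 → y ≠ 1 → x = y)
    (hcard : Nat.card B ∣ 8) : phi A ∣ phi B := by
  have key (C : Subgroup G) (hC : C ≤ B) :
      (phi C = 1 ∧ Nat.card C ≤ 2) ∨ (4 ∣ Nat.card C ∧ phi C + 2 = Nat.card C) := by
    refine phi_of_pow_four_eq_one (fun x => Subtype.ext (h4 x (hC x.2))) fun x y hx hy hx1 hy1 =>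
      Subtype.ext (hinv x (hC x.2) y (hC y.2) ?_ ?_ ?_ ?_)
    · exact_mod_cast hx
    · exact_mod_cast hy
    · exact_mod_cast hx1
    · exact_mod_cast hy1
  have hdvd := Subgroup.card_dvd_of_le hAB
  rcases key A hAB with ⟨hA, -⟩ | ⟨hA, hA'⟩
  · simp [hA]
  have eight (n : ℕ) (hn : n ∣ 8) (h : 4 ∣ n) : n = 4 ∨ n = 8 := by
    have := Nat.le_of_dvd (by norm_num) hn
    interval_cases n <;> omega
  have hcA := eight _ (hdvd.trans hcard) hA
  have hcB := eight _ hcard (hA.trans hdvd)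
  have hle := Nat.le_of_dvd (by omega) hdvd
  rcases key B le_rfl with ⟨-, hB⟩ | ⟨-, hB'⟩
  · omega
  · rcases hcA with h | h <;> rcases hcB with h' | h' <;> (rw [h] at hA'; rw [h'] at hB')
    · exact (show phi A = phi B by omega) ▸ dvd_rfl
    · exact (show phi A = 2 by omega) ▸ (show phi B = 6 by omega) ▸ by norm_num
    · omega
    · exact (show phi A = phi B by omega) ▸ dvd_rfl

theorem phi_dvd_of_le_of_isCyclic {G : Type*} [Group G] [Finite G] {A B : Subgroup G}
    (hAB : A ≤ B) [IsCyclic B] : phi A ∣ phi B := by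
  have : IsCyclic A := isCyclic_of_injective (Subgroup.inclusion hAB)
    (Subgroup.inclusion_injective hAB)
  rw [phi_of_isCyclic, phi_of_isCyclic]
  exact Nat.totient_dvd_of_dvd (Subgroup.card_dvd_of_le hAB)

/-- In a finite nilpotent group, a Sylow `p`-subgroup contains every `p`-subgroup. -/
theorem IsPGroup.le_sylow_of_isNilpotent {G : Type*} [Group G] [Finite G] [Group.IsNilpotent G]
    {p : ℕ} [Fact p.Prime] {Q : Subgroup G} (hQ : IsPGroup p Q) (P : Sylow p G) :
    Q ≤ P := by
  obtain ⟨R, hR⟩ := hQ.exists_le_sylow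
  have : Unique (Sylow p G) := Sylow.unique_of_normal P inferInstance
  rwa [Subsingleton.elim R P] at hR

theorem phi_dvd_of_le_sylow {G : Type*} [Group G] [Finite G] {p : ℕ} (hp : p.Prime)
    {A B P : Subgroup G} (hAB : A ≤ B) (hBP : B ≤ P)
    (hP : IsCyclic P ∨ Nonempty (P ≃* QuaternionGroup 2) ∨
      Nonempty (P ≃* (Multiplicative (ZMod p) × Multiplicative (ZMod p)))) :
    phi A ∣ phi B := by
  rcases hP with hP | ⟨⟨e⟩⟩ | ⟨⟨e⟩⟩
  · have : IsCyclic B := isCyclic_of_injective (Subgroup.inclusion hBP)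
      (Subgroup.inclusion_injective hBP)
    exact phi_dvd_of_le_of_isCyclic hAB
  · have h4 : ∀ q : QuaternionGroup 2, q ^ 4 = 1 := by decide
    have hinv : ∀ q r : QuaternionGroup 2, q ^ 2 = 1 → r ^ 2 = 1 → q ≠ 1 → r ≠ 1 → q = r := by
      decide
    have h4P (x : P) : x ^ 4 = 1 := e.injective (by rw [map_pow, h4, map_one])
    have hinvP (x y : P) (hx : x ^ 2 = 1) (hy : y ^ 2 = 1) (hx1 : x ≠ 1) (hy1 : y ≠ 1) : x = y :=
      e.injective (hinv _ _ (by rw [← map_pow, hx, map_one]) (by rw [← map_pow, hy, map_one])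
        (by simpa using hx1) (by simpa using hy1))
    refine phi_dvd_of_pow_four_eq_one hAB (fun x hx => ?_) (fun x hx y hy h h' h1 h1' => ?_) ?_
    · exact congrArg Subtype.val (h4P ⟨x, hBP hx⟩)
    · refine congrArg Subtype.val (hinvP ⟨x, hBP hx⟩ ⟨y, hBP hy⟩ (Subtype.ext h) (Subtype.ext h')
        (fun h => h1 (congrArg Subtype.val h)) (fun h => h1' (congrArg Subtype.val h)))
    · refine (Subgroup.card_dvd_of_le hBP).trans ?_
      rw [Nat.card_congr e.toEquiv, Nat.card_eq_fintype_card, QuaternionGroup.card]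
  · have hc : Nat.card (Multiplicative (ZMod p)) = p := Nat.card_zmod p
    have hpow_zmod (y : Multiplicative (ZMod p)) : y ^ p = 1 := by
      simpa only [hc] using pow_card_eq_one' (x := y)
    have hpow (x : P) : x ^ p = 1 := e.injective (by
      rw [map_pow, map_one]
      exact Prod.ext (hpow_zmod _) (hpow_zmod _))
    refine phi_dvd_of_pow_prime_eq_one hAB hp (fun x hx => ?_) ?_
    · exact congrArg Subtype.val (hpow ⟨x, hBP hx⟩)
    · refine (Subgroup.card_dvd_of_le hBP).trans ?_
      rw [Nat.card_congr e.toEquiv, Nat.card_prod, hc, sq]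

theorem stmt_2 (G : Type*) [Group G] [Finite G]
    (hnil : Group.IsNilpotent G)
    (hSyl : ∀ (p : ℕ) (_ : Fact p.Prime) (P : Sylow p G),
      IsCyclic P ∨ Nonempty (P ≃* QuaternionGroup 2) ∨
        Nonempty (P ≃* (Multiplicative (ZMod p) × Multiplicative (ZMod p)))) :
    ∀ H K : Subgroup G, H ≤ K → phi H ∣ phi K := by
  intro H K hHK
  rw [phi_eq_prod_sylow H, phi_eq_prod_sylow K]
  refine (Finset.prod_dvd_prod_of_dvd _ _ fun p hp => ?_).trans
    (Finset.prod_dvd_prod_of_subset _ _ _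
      (Nat.primeFactors_mono (Subgroup.card_dvd_of_le hHK) Nat.card_pos.ne'))
  have hp' : Fact p.Prime := ⟨Nat.prime_of_mem_primeFactors hp⟩
  set S : Sylow p H := default
  set T : Sylow p K := default
  rw [phi_congr ((S : Subgroup H).equivMapOfInjective H.subtype H.subtype_injective),
    phi_congr ((T : Subgroup K).equivMapOfInjective K.subtype K.subtype_injective)]
  refine phi_dvd_of_le_sylow (P := (default : Sylow p G)) hp'.out ?_ ?_ (hSyl p hp' default)
  · have hle : (S : Subgroup H).map (Subgroup.inclusion hHK) ≤ T :=
      (S.isPGroup'.map _).le_sylow_of_isNilpotent T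
    have := Subgroup.map_mono (f := K.subtype) hle
    rwa [Subgroup.map_map, Subgroup.subtype_comp_inclusion] at this
  · exact (T.isPGroup'.map _).le_sylow_of_isNilpotent default
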